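/- For every nonnegative integer N, the generating function of symmetric plane partitions with at most N rows and at most N columns (and unbounded entries) equals ∏_{i=0}^{N−1} [ (1 − q^{2i+1}) · ∏_{j=0}^{i−1} (1 − q^{2(i+j+1)}) ]^{−1} in ℤ[[q]]. That is, Σ_π q^{|π|} taken over all arrays (π_{i,j})_{1≤i,j≤N} of nonnegative integers that are weakly decreasing along rows and columns and satisfy π_{i,j} = π_{j,i} equals this product. -/

import Mathlib

open Finset PowerSeries

noncomputable section

/-- The size of a plane partition supported in the `N × N` rectangle. -/
def ppSize (N : ℕ) (π : ℕ → ℕ → ℕ) : ℕ := ∑ i ∈ range N, ∑ j ∈ range N, π i j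

/-- A symmetric plane partition with at most `N` rows and at most `N` columns (unbounded
entries): 0-indexed entries `π i j`, weakly decreasing in each argument, symmetric, and
vanishing outside the `N × N` rectangle. -/
def IsSymPP (N : ℕ) (π : ℕ → ℕ → ℕ) : Prop :=
  (∀ i j, π i (j + 1) ≤ π i j) ∧ (∀ i j, π (i + 1) j ≤ π i j) ∧
  (∀ i j, π i j = π j i) ∧ (∀ i j, N ≤ i ∨ N ≤ j → π i j = 0)

def ILace (μ l : ℕ → ℕ) : Prop := ∀ k, μ k ≤ l k ∧ l (k + 1) ≤ μ k

def loc (κ μ ν : ℕ → ℕ) (n : ℕ) : ℕ → ℕ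
  | 0 => max (μ 0) (ν 0) + n
  | k + 1 => max (μ (k + 1)) (ν (k + 1)) + min (μ k) (ν k) - κ k

def unlocK (μ ν l : ℕ → ℕ) : ℕ → ℕ := fun k =>
  max (μ (k + 1)) (ν (k + 1)) + min (μ k) (ν k) - l (k + 1)

def unlocN (μ ν l : ℕ → ℕ) : ℕ := l 0 - max (μ 0) (ν 0)

theorem loc_inter {κ μ ν : ℕ → ℕ} (h1 : ILace κ μ) (h2 : ILace κ ν) (n : ℕ) :
    ILace μ (loc κ μ ν n) ∧ ILace ν (loc κ μ ν n) := by
  refine ⟨fun k => ⟨?_, ?_⟩, fun k => ⟨?_, ?_⟩⟩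
  · cases k with
    | zero => simp only [loc]; omega
    | succ k => have := h1 k; have := h2 k; simp only [loc]; omega
  · have := h1 k; have := h2 k; simp only [loc]; omega
  · cases k with
    | zero => simp only [loc]; omega
    | succ k => have := h1 k; have := h2 k; simp only [loc]; omega
  · have := h1 k; have := h2 k; simp only [loc]; omega

theorem unloc_inter {μ ν l : ℕ → ℕ} (h1 : ILace μ l) (h2 : ILace ν l) :
    ILace (unlocK μ ν l) μ ∧ ILace (unlocK μ ν l) ν := by
  refine ⟨fun k => ?_, fun k => ?_⟩
  all_goals
    have := h1 k; have := h2 k; have := h1 (k+1); have := h2 (k+1)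
    simp only [unlocK]; omega

theorem unlocK_loc {κ μ ν : ℕ → ℕ} (h1 : ILace κ μ) (h2 : ILace κ ν) (n : ℕ) :
    unlocK μ ν (loc κ μ ν n) = κ := by
  funext k
  have := h1 k; have := h2 k; simp only [unlocK, loc]; omega

theorem unlocN_loc (κ μ ν : ℕ → ℕ) (n : ℕ) : unlocN μ ν (loc κ μ ν n) = n := by
  simp only [unlocN, loc]; omega

theorem loc_unloc {μ ν l : ℕ → ℕ} (h1 : ILace μ l) (h2 : ILace ν l) :
    loc (unlocK μ ν l) μ ν (unlocN μ ν l) = l := by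
  funext k
  cases k with
  | zero => have := h1 0; have := h2 0; simp only [unlocN, loc]; omega
  | succ k =>
    have := h1 k; have := h2 k; have := h1 (k+1); have := h2 (k+1)
    simp only [unlocK, loc]; omega

def sz (j : ℕ) (l : ℕ → ℕ) : ℕ := ∑ k ∈ range j, l k

theorem sz_loc_aux {κ μ ν : ℕ → ℕ} (h1 : ILace κ μ) (h2 : ILace κ ν) (n : ℕ) (j : ℕ) :
    sz (j + 1) (loc κ μ ν n) + sz j κ + min (μ j) (ν j) = sz (j + 1) μ + sz (j + 1) ν + n := by
  induction j with
  | zero => simp [sz, loc]; omega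
  | succ j ih =>
    simp only [sz] at ih ⊢
    rw [sum_range_succ _ (j+1), sum_range_succ κ j, sum_range_succ μ (j+1),
      sum_range_succ ν (j+1)]
    have := h1 j; have := h2 j
    simp only [loc] at ih ⊢; omega

theorem sz_loc {κ μ ν : ℕ → ℕ} (h1 : ILace κ μ) (h2 : ILace κ ν) (n : ℕ) (j : ℕ)
    (h : ν j = 0) :
    sz (j + 1) (loc κ μ ν n) + sz j κ = sz (j + 1) μ + sz j ν + n := by
  have := sz_loc_aux h1 h2 n j
  have h3 : sz (j + 1) ν = sz j ν := by simp [sz, sum_range_succ, h]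
  omega

def IsCh (j : ℕ) (ρ : ℕ → ℕ → ℕ) : Prop := (∀ d, ILace (ρ (d + 1)) (ρ d)) ∧ ρ j = 0

def tl (ρ : ℕ → ℕ → ℕ) : ℕ → ℕ → ℕ := fun d => ρ (d + 1)

def cns (l : ℕ → ℕ) (ρ : ℕ → ℕ → ℕ) : ℕ → ℕ → ℕ
  | 0 => l
  | d + 1 => ρ d

theorem tl_cns (l ρ) : tl (cns l ρ) = ρ := rfl
theorem cns_tl (ρ) : cns (ρ 0) (tl ρ) = ρ := by
  funext d; cases d <;> rfl

theorem IsCh.tl {j ρ} (h : IsCh (j + 1) ρ) : IsCh j (tl ρ) := ⟨fun d => h.1 (d + 1), h.2⟩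

theorem IsCh.cns {j ρ l} (h : IsCh j ρ) (hl : ILace (ρ 0) l) : IsCh (j + 1) (cns l ρ) :=
  ⟨fun d => by cases d with
    | zero => exact hl
    | succ d => exact h.1 d, h.2⟩

theorem IsCh.zero_after {j ρ} (h : IsCh j ρ) (d : ℕ) : ρ (j + d) = 0 := by
  induction d with
  | zero => exact h.2
  | succ d ih =>
    funext k
    have := (h.1 (j + d) k).1
    rw [ih] at this
    exact Nat.le_zero.1 this

theorem IsCh.zero {j ρ} (h : IsCh j ρ) (k : ℕ) : ∀ d, j ≤ d + k → ρ d k = 0 := by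
  induction k with
  | zero =>
    intro d hd
    have := h.zero_after (d - j)
    rw [show j + (d - j) = d by omega] at this
    simp [this]
  | succ k ih =>
    intro d hd
    have h1 := (h.1 d k).2
    have := ih (d + 1) (by omega)
    omega

def wt : ℕ → (ℕ → ℕ → ℕ) → ℕ
  | 0, _ => 0
  | j + 1, ρ => wt j (tl ρ) + sz j (ρ 1)

def VV : ℕ → Type
  | 0 => Unit
  | j + 1 => VV j × ℕ

def vs : (j : ℕ) → VV j → ℕ
  | 0, _ => 0
  | j + 1, a => vs j a.1 + a.2

def vp : (j : ℕ) → VV j → ℕ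
  | 0, _ => 0
  | j + 1, a => vp j a.1 + vs j a.1

def AA (j : ℕ) : Type := {ρ : ℕ → ℕ → ℕ // IsCh j ρ}
def BB (j : ℕ) : Type := {x : (ℕ → ℕ) × (ℕ → ℕ → ℕ) // IsCh j x.2 ∧ ILace x.1 (x.2 0)}

theorem inter_zero {κ : ℕ → ℕ} (h : ILace κ 0) : κ = 0 := by
  funext k; have := (h k).1; simpa using this

theorem ch_zero {ρ} (h : IsCh 0 ρ) : ρ = 0 := by
  funext d; have := h.zero_after d; simpa using this

theorem ch_zero' : IsCh 0 0 := ⟨fun d k => by simp, rfl⟩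

theorem row_equiv (j : ℕ) : ∃ e : AA j × VV j ≃ BB j, ∀ x,
    (e x).1.1 = x.1.1 0 ∧ sz j ((e x).1.2 0) = sz j (x.1.1 0) + vs j x.2 ∧
    wt j (e x).1.2 = wt j x.1.1 + vp j x.2 := by
  induction j with
  | zero =>
    refine ⟨⟨fun x => ⟨(0, 0), ch_zero', fun k => by simp⟩, fun _ => (⟨0, ch_zero'⟩, ()), ?_, ?_⟩, ?_⟩
    · rintro ⟨⟨ρ, h⟩, u⟩
      exact Prod.ext (Subtype.ext (ch_zero h).symm) rfl
    · rintro ⟨⟨κ, σ⟩, h, h'⟩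
      have := ch_zero h
      simp only at this
      subst this
      have := inter_zero h'
      simp only at this
      subst this
      rfl
    · rintro ⟨⟨ρ, h⟩, u⟩
      have := ch_zero h
      subst this
      exact ⟨rfl, rfl, rfl⟩
  | succ j ih =>
    obtain ⟨e, he⟩ := ih
    have hs : ∀ y : BB j, (e.symm y).1.1 0 = y.1.1 := fun y => by
      have := (he (e.symm y)).1
      rw [e.apply_symm_apply] at this
      exact this.symm
    have key : ∀ x : AA (j+1) × VV (j+1),
        ILace (e (⟨tl x.1.1, x.1.2.tl⟩, x.2.1)).1.1 (x.1.1 0) := fun x => by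
      rw [(he _).1]; exact x.1.2.1 0
    refine ⟨⟨fun x =>
        ⟨(x.1.1 0, cns (loc (e (⟨tl x.1.1, x.1.2.tl⟩, x.2.1)).1.1 (x.1.1 0)
            ((e (⟨tl x.1.1, x.1.2.tl⟩, x.2.1)).1.2 0) x.2.2)
            (e (⟨tl x.1.1, x.1.2.tl⟩, x.2.1)).1.2),
          (e (⟨tl x.1.1, x.1.2.tl⟩, x.2.1)).2.1.cns (loc_inter (key x) (e _).2.2 _).2,
          (loc_inter (key x) (e _).2.2 _).1⟩,
      fun y => 
        (⟨cns y.1.1 (e.symm ⟨(unlocK y.1.1 (y.1.2 1) (y.1.2 0), tl y.1.2), y.2.1.tl,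
            (unloc_inter y.2.2 (y.2.1.1 0)).2⟩).1.1, 
            IsCh.cns (e.symm _).1.2
              ((congrArg (fun z => ILace z y.1.1) (hs _)).mpr (unloc_inter y.2.2 (y.2.1.1 0)).1)⟩,
          ((e.symm ⟨(unlocK y.1.1 (y.1.2 1) (y.1.2 0), tl y.1.2), y.2.1.tl,
            (unloc_inter y.2.2 (y.2.1.1 0)).2⟩).2, unlocN y.1.1 (y.1.2 1) (y.1.2 0))), 
      ?_, ?_⟩, ?_⟩
    · intro x
      have h3 : ∀ z : BB j, z = e (⟨tl x.1.1, x.1.2.tl⟩, x.2.1) → 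
        e.symm z = (⟨tl x.1.1, x.1.2.tl⟩, x.2.1) := by
        rintro z rfl; simp
      have h4 := h3 ⟨(unlocK (x.1.1 0) ((e (⟨tl x.1.1, x.1.2.tl⟩, x.2.1)).1.2 0) 
        (loc (e (⟨tl x.1.1, x.1.2.tl⟩, x.2.1)).1.1 (x.1.1 0)
            ((e (⟨tl x.1.1, x.1.2.tl⟩, x.2.1)).1.2 0) x.2.2), 
          (e (⟨tl x.1.1, x.1.2.tl⟩, x.2.1)).1.2), (e (⟨tl x.1.1, x.1.2.tl⟩, x.2.1)).2.1, by
            rw [unlocK_loc (key x) (e _).2.2]; exact (e _).2.2⟩ (by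
            apply Subtype.ext
            dsimp only
            rw [unlocK_loc (key x) (e _).2.2])
      refine Prod.ext (Subtype.ext ?_) (Prod.ext ?_ ?_)
      · refine Eq.trans (congrArg (fun z : AA j × VV j => cns (x.1.1 0) z.1.1) h4) ?_
        exact cns_tl _
      · exact congrArg (fun z : AA j × VV j => z.2) h4
      · exact unlocN_loc (e (⟨tl x.1.1, x.1.2.tl⟩, x.2.1)).1.1 (x.1.1 0) ((e (⟨tl x.1.1, x.1.2.tl⟩, x.2.1)).1.2 0) x.2.2
    · intro y
      apply Subtype.ext
      refine Prod.ext rfl ?_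
      dsimp only [cns]
      have h5 : ∀ z : AA j × VV j, ∀ (hz : IsCh j (tl (cns y.1.1 z.1.1))),
        ((⟨tl (cns y.1.1 z.1.1), hz⟩, z.2) : AA j × VV j) = z := fun z hz => rfl
      simp only [h5]
      have := loc_unloc y.2.2 (y.2.1.1 0)
      refine Eq.trans ?_ (cns_tl y.1.2)
      refine Eq.trans (congrArg (fun z : BB j => cns (loc z.1.1 y.1.1 (z.1.2 0)
        (unlocN y.1.1 (y.1.2 1) (y.1.2 0))) z.1.2) (e.apply_symm_apply _)) ?_
      exact congrArg (fun l => cns l (tl y.1.2)) this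
    · intro x
      obtain ⟨h1, h2, h3⟩ := he (⟨tl x.1.1, x.1.2.tl⟩, x.2.1)
      have h0 := (e (⟨tl x.1.1, x.1.2.tl⟩, x.2.1)).2.1.zero j 0 (by omega)
      have h4 := sz_loc (key x) (e (⟨tl x.1.1, x.1.2.tl⟩, x.2.1)).2.2 x.2.2 j h0
      have h1' : sz j (e (⟨tl x.1.1, x.1.2.tl⟩, x.2.1)).1.1 = sz j (x.1.1 1) := congrArg (sz j) h1
      have h2' : sz j ((e (⟨tl x.1.1, x.1.2.tl⟩, x.2.1)).1.2 0) = sz j (x.1.1 1) + vs j x.2.1 := h2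
      have h3' : wt j (e (⟨tl x.1.1, x.1.2.tl⟩, x.2.1)).1.2 = wt j (tl x.1.1) + vp j x.2.1 := h3
      refine ⟨rfl, ?_, ?_⟩
      · change sz (j + 1) (loc (e (⟨tl x.1.1, x.1.2.tl⟩, x.2.1)).1.1 (x.1.1 0) ((e (⟨tl x.1.1, x.1.2.tl⟩, x.2.1)).1.2 0) x.2.2) =
          sz (j + 1) (x.1.1 0) + (vs j x.2.1 + x.2.2)
        omega
      · change wt j (e (⟨tl x.1.1, x.1.2.tl⟩, x.2.1)).1.2 + sz j ((e (⟨tl x.1.1, x.1.2.tl⟩, x.2.1)).1.2 0) =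
          (wt j (tl x.1.1) + sz j (x.1.1 1)) + (vp j x.2.1 + vs j x.2.1)
        omega

theorem main_equiv (M : ℕ) : ∃ e : (AA M × VV M) × ℕ ≃ AA (M + 1), ∀ x,
    sz (M + 1) ((e x).1 0) = sz M (x.1.1.1 0) + 2 * vs M x.1.2 + x.2 ∧
    wt (M + 1) (e x).1 = wt M x.1.1.1 + vp M x.1.2 + sz M (x.1.1.1 0) + vs M x.1.2 := by
  obtain ⟨e, he⟩ := row_equiv M
  refine ⟨(e.prodCongr (Equiv.refl ℕ)).trans ⟨fun y =>
    ⟨cns (loc y.1.1.1 (y.1.1.2 0) (y.1.1.2 0) y.2) y.1.1.2,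
      y.1.2.1.cns (loc_inter y.1.2.2 y.1.2.2 _).1⟩,
    fun r => (⟨(unlocK (r.1 1) (r.1 1) (r.1 0), tl r.1), r.2.tl, 
      (unloc_inter (r.2.1 0) (r.2.1 0)).1⟩, unlocN (r.1 1) (r.1 1) (r.1 0)), ?_, ?_⟩, ?_⟩
  · rintro ⟨⟨⟨κ, σ⟩, h, h'⟩, n⟩
    refine Prod.ext (Subtype.ext (Prod.ext ?_ ?_)) ?_
    · exact unlocK_loc h' h' n
    · rfl
    · exact unlocN_loc κ (σ 0) (σ 0) n
  · rintro ⟨r, h⟩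
    apply Subtype.ext
    refine Eq.trans ?_ (cns_tl r)
    exact congrArg (fun l => cns l (tl r)) (loc_unloc (h.1 0) (h.1 0))
  · rintro ⟨x, n⟩
    obtain ⟨h1, h2, h3⟩ := he x
    have h0 := (e x).2.1.zero M 0 (by omega)
    have h4 := sz_loc (e x).2.2 (e x).2.2 n M h0
    have h5 : sz (M + 1) ((e x).1.2 0) = sz M ((e x).1.2 0) := by
      simp [sz, sum_range_succ, h0]
    refine ⟨?_, ?_⟩
    · change sz (M + 1) (loc (e x).1.1 ((e x).1.2 0) ((e x).1.2 0) n) = _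
      rw [h1] at h4 ⊢
      dsimp only
      omega
    · change wt M (e x).1.2 + sz M ((e x).1.2 0) = _
      dsimp only
      omega

def HasGF {S : Type} (w : S → ℕ) (F : PowerSeries ℤ) : Prop :=
  ∀ n, Finite {s // w s = n} ∧ (Nat.card {s // w s = n} : ℤ) = coeff n F

theorem HasGF.equiv {S T : Type} {w : S → ℕ} {w' : T → ℕ} {F} (h : HasGF w F) (e : S ≃ T)
    (he : ∀ s, w' (e s) = w s) : HasGF w' F := by
  intro n
  have e' : {s // w s = n} ≃ {t // w' t = n} := e.subtypeEquiv (fun s => by rw [he])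
  obtain ⟨h1, h2⟩ := h n
  exact ⟨Finite.of_equiv _ e', by rw [← h2, Nat.card_congr e']⟩

theorem HasGF.prod {S T : Type} {w : S → ℕ} {w' : T → ℕ} {F G} (h : HasGF w F)
    (h' : HasGF w' G) : HasGF (fun x : S × T => w x.1 + w' x.2) (F * G) := by
  intro n
  let e : {x : S × T // w x.1 + w' x.2 = n} ≃
      Σ p : antidiagonal n, {s // w s = p.1.1} × {t // w' t = p.1.2} :=
    { toFun := fun x => ⟨⟨(w x.1.1, w' x.1.2), by simp [x.2]⟩, ⟨x.1.1, rfl⟩, ⟨x.1.2, rfl⟩⟩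
      invFun := fun y => ⟨(y.2.1.1, y.2.2.1), by
        have := y.1.2; rw [HasAntidiagonal.mem_antidiagonal] at this
        rw [y.2.1.2, y.2.2.2, this]⟩
      left_inv := fun x => rfl
      right_inv := by
        rintro ⟨⟨⟨p, q⟩, hp⟩, ⟨s, hs⟩, ⟨t, ht⟩⟩
        dsimp only at hs ht
        subst hs; subst ht; rfl }
  have f1 := fun n => (h n).1
  have f2 := fun n => (h' n).1
  refine ⟨Finite.of_equiv _ e.symm, ?_⟩
  rw [Nat.card_congr e, Nat.card_sigma, coeff_mul]
  push_cast
  rw [← Finset.sum_coe_sort (antidiagonal n)]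
  refine Finset.sum_congr rfl fun p _ => ?_
  rw [Nat.card_prod]
  push_cast
  rw [(h _).2, (h' _).2]

def iv (c : ℕ) : PowerSeries ℤ := Ring.inverse (1 - (X : PowerSeries ℤ) ^ c)

theorem isUnit_one_sub {c : ℕ} (hc : 1 ≤ c) : IsUnit (1 - (X : PowerSeries ℤ) ^ c) := by
  rw [PowerSeries.isUnit_iff_constantCoeff]
  simp [show c ≠ 0 by omega]

theorem iv_eq {c : ℕ} (hc : 1 ≤ c) : iv c = PowerSeries.mk fun n => if c ∣ n then 1 else 0 := by
  have hu := isUnit_one_sub hc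
  have h : (PowerSeries.mk fun n => if c ∣ n then (1:ℤ) else 0) * (1 - (X : PowerSeries ℤ) ^ c) = 1 := by
    ext n
    rw [mul_sub, mul_one, map_sub, coeff_mul_X_pow', coeff_mk, coeff_one]
    by_cases hn : c ≤ n
    · have : c ∣ n ↔ c ∣ n - c := by
        rw [Nat.dvd_sub_iff_left hn (dvd_refl c)]
      rw [if_pos hn, coeff_mk, if_neg (show n ≠ 0 by omega)]
      simp only [this, sub_self]
    · by_cases h0 : n = 0
      · subst h0; simp [hn]
      · have : ¬ c ∣ n := fun hd => hn (Nat.le_of_dvd (by omega) hd)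
        simp [hn, this, h0]
  refine hu.mul_right_cancel ?_
  rw [h, iv, Ring.inverse_mul_cancel _ hu]

theorem hasGF_nat {c : ℕ} (hc : 1 ≤ c) : HasGF (fun n : ℕ => c * n) (iv c) := by
  intro n
  rw [iv_eq hc, coeff_mk]
  have hs : Subsingleton {s // c * s = n} := ⟨fun a b => Subtype.ext
    (Nat.eq_of_mul_eq_mul_left hc (a.2.trans b.2.symm))⟩
  refine ⟨inferInstance, ?_⟩
  split_ifs with h
  · obtain ⟨k, hk⟩ := h
    have : Nonempty {s // c * s = n} := ⟨⟨k, hk.symm⟩⟩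
    have : Nat.card {s // c * s = n} = 1 := Nat.card_eq_one_iff_unique.2 ⟨hs, this⟩
    rw [this]; rfl
  · have : IsEmpty {s // c * s = n} := ⟨fun a => h ⟨a.1, a.2.symm⟩⟩
    simp

theorem hasGF_one {S : Type} [Unique S] {w : S → ℕ} (hw : w default = 0) : HasGF w 1 := by
  intro n
  refine ⟨inferInstance, ?_⟩
  rw [coeff_one]
  split_ifs with h
  · have : Nat.card {s // w s = n} = 1 := Nat.card_eq_one_iff_unique.2
      ⟨inferInstance, ⟨⟨default, by rw [hw, h]⟩⟩⟩
    rw [this]; rfl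
  · have : IsEmpty {s // w s = n} := ⟨fun a => h (by
      rw [← a.2, Unique.eq_default a.1, hw])⟩
    simp

theorem hasGF_VV (j : ℕ) : ∀ α, 1 ≤ α →
    HasGF (fun a : VV j => α * vs j a + 2 * vp j a) (∏ i ∈ range j, iv (α + 2 * i)) := by
  induction j with
  | zero =>
    intro α _
    have : Unique (VV 0) := inferInstanceAs (Unique Unit)
    exact hasGF_one (by simp [vs, vp])
  | succ j ih =>
    intro α hα
    have := (ih (α + 2) (by omega)).prod (hasGF_nat hα)
    rw [prod_range_succ']
    have h2 : ∏ k ∈ range j, iv (α + 2 * (k + 1)) = ∏ i ∈ range j, iv (α + 2 + 2 * i) :=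
      prod_congr rfl fun i _ => by congr 1; ring
    rw [h2]
    refine this.equiv (Equiv.refl _) ?_
    rintro ⟨a, n⟩
    change α * (vs j a + n) + 2 * (vp j a + vs j a) = (α + 2) * vs j a + 2 * vp j a + α * n
    ring

theorem hasGF_AA (M : ℕ) : ∀ c, 1 ≤ c →
    HasGF (fun r : AA M => c * sz M (r.1 0) + 2 * wt M r.1)
      (∏ s ∈ range M, (iv (c + 2 * s) *
        ∏ i ∈ range (M - 1 - s), iv (2 * (c + 2 * s) + 2 + 2 * i))) := by
  induction M with
  | zero =>
    intro c _
    have : Unique (AA 0) := ⟨⟨⟨0, ch_zero'⟩⟩, fun r => Subtype.ext (ch_zero r.2)⟩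
    exact hasGF_one (by simp [sz, wt])
  | succ M ih =>
    intro c hc
    obtain ⟨e, he⟩ := main_equiv M
    have := ((ih (c + 2) (by omega)).prod (hasGF_VV M (2 * c + 2) (by omega))).prod (hasGF_nat hc)
    rw [prod_range_succ']
    have h2 : ∏ s ∈ range M, (iv (c + 2 * (s + 1)) *
        ∏ i ∈ range (M + 1 - 1 - (s + 1)), iv (2 * (c + 2 * (s + 1)) + 2 + 2 * i))
        = ∏ s ∈ range M, (iv (c + 2 + 2 * s) *
        ∏ i ∈ range (M - 1 - s), iv (2 * (c + 2 + 2 * s) + 2 + 2 * i)) :=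
      prod_congr rfl fun s _ => by
        rw [show c + 2 * (s + 1) = c + 2 + 2 * s by ring,
          show M + 1 - 1 - (s + 1) = M - 1 - s by omega]
    rw [h2]
    have h3 : (iv (c + 2 * 0) * ∏ i ∈ range (M + 1 - 1 - 0), iv (2 * (c + 2 * 0) + 2 + 2 * i))
      = (∏ i ∈ range M, iv (2 * c + 2 + 2 * i)) * iv c := by
      simp [mul_comm]
    rw [h3, ← mul_assoc]
    refine this.equiv e fun x => ?_
    obtain ⟨h4, h5⟩ := he x
    rw [h4, h5]
    ring

theorem ppSize_symm (π : ℕ → ℕ → ℕ) (h : ∀ i j, π i j = π j i) (N : ℕ) :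
    ppSize N π = sz N (fun i => π i i) + 2 * ∑ j ∈ range N, ∑ i ∈ range j, π i j := by
  induction N with
  | zero => simp [ppSize, sz]
  | succ N ih =>
    have h1 : ∑ j ∈ range N, π N j = ∑ i ∈ range N, π i N := sum_congr rfl fun i _ => h _ _
    simp only [ppSize, sz] at ih ⊢
    simp only [sum_range_succ, sum_add_distrib]
    omega

theorem wt_eq (N : ℕ) : ∀ ρ, wt N ρ = ∑ j ∈ range N, ∑ i ∈ range j, ρ (j - i) i := by
  induction N with
  | zero => intro ρ; simp [wt]
  | succ N ih =>
    intro ρ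
    rw [wt, ih, sum_range_succ']
    simp only [range_zero, sum_empty, add_zero, sum_range_succ, sum_add_distrib, sz]
    congr 1
    · refine sum_congr rfl fun j _ => sum_congr rfl fun i hi => ?_
      rw [mem_range] at hi
      rw [tl, show j + 1 - i = j - i + 1 by omega]
    · refine sum_congr rfl fun j _ => ?_
      rw [show j + 1 - j = 1 by omega]

def toPP (ρ : ℕ → ℕ → ℕ) : ℕ → ℕ → ℕ := fun i j => ρ (max i j - min i j) (min i j)

theorem toPP_le {N ρ} (h : IsCh N ρ) (i j : ℕ) : toPP ρ i (j + 1) ≤ toPP ρ i j := by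
  unfold toPP
  by_cases hij : i ≤ j
  · rw [show max i (j+1) - min i (j+1) = j - i + 1 by omega, show min i (j+1) = i by omega,
      show max i j - min i j = j - i by omega, show min i j = i by omega]
    exact (h.1 _ _).1
  · rw [show max i (j+1) - min i (j+1) = i - (j + 1) by omega, show min i (j+1) = j + 1 by omega,
      show max i j - min i j = i - (j + 1) + 1 by omega, show min i j = j by omega]
    exact (h.1 _ _).2

theorem toPP_symm (ρ : ℕ → ℕ → ℕ) (i j : ℕ) : toPP ρ i j = toPP ρ j i := by
  unfold toPP; rw [max_comm, min_comm]

def ppEquiv (N : ℕ) : AA N ≃ {π : ℕ → ℕ → ℕ // IsSymPP N π} where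
  toFun r := ⟨toPP r.1, toPP_le r.2, fun i j => by
    rw [toPP_symm _ (i + 1), toPP_symm _ i]; exact toPP_le r.2 _ _, toPP_symm _, fun i j hij =>
      r.2.zero _ _ (by omega)⟩
  invFun p := ⟨fun d k => p.1 k (k + d), fun d k => ⟨p.2.1 _ _, by
    have := p.2.2.1 k (k + 1 + d)
    dsimp only
    rwa [show k + (d + 1) = k + 1 + d by ring]⟩, by
      funext k; exact p.2.2.2.2 _ _ (by omega)⟩
  left_inv r := by
    apply Subtype.ext
    funext d k
    simp [toPP]
  right_inv p := by
    apply Subtype.ext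
    funext i j
    dsimp only [toPP]
    rcases le_total i j with h | h
    · rw [min_eq_left h, max_eq_right h, Nat.add_sub_cancel' h]
    · rw [min_eq_right h, max_eq_left h, Nat.add_sub_cancel' h, p.2.2.2.1]

theorem ppEquiv_size (N : ℕ) (r : AA N) :
    ppSize N (ppEquiv N r).1 = 1 * sz N (r.1 0) + 2 * wt N r.1 := by
  change ppSize N (toPP r.1) = _
  rw [ppSize_symm _ (toPP_symm _), wt_eq, one_mul]
  congr 2
  · simp [toPP]
  · refine sum_congr rfl fun j _ => sum_congr rfl fun i hi => ?_
    rw [mem_range] at hi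
    rw [toPP, min_eq_left hi.le, max_eq_right hi.le]

theorem inverse_prod (i : ℕ) : Ring.inverse
          ((1 - (X : PowerSeries ℤ) ^ (2 * i + 1)) *
            ∏ j ∈ range i, (1 - (X : PowerSeries ℤ) ^ (2 * (i + j + 1))))
    = iv (2 * i + 1) * ∏ j ∈ range i, iv (2 * (i + j + 1)) := by
  rw [Ring.mul_inverse_rev]
  have : ∀ s : ℕ, Ring.inverse (∏ j ∈ range s, (1 - (X : PowerSeries ℤ) ^ (2 * (i + j + 1))))
      = ∏ j ∈ range s, iv (2 * (i + j + 1)) := by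
    intro s
    induction s with
    | zero => simp
    | succ s ih => rw [prod_range_succ, prod_range_succ, Ring.mul_inverse_rev, ih, mul_comm, iv]
  rw [this, mul_comm, iv]

theorem prod_rearrange (N : ℕ) : ∏ s ∈ range N, (iv (1 + 2 * s) *
        ∏ i ∈ range (N - 1 - s), iv (2 * (1 + 2 * s) + 2 + 2 * i))
    = ∏ i ∈ range N, (iv (2 * i + 1) * ∏ j ∈ range i, iv (2 * (i + j + 1))) := by
  rw [prod_mul_distrib, prod_mul_distrib]
  congr 1
  · exact prod_congr rfl fun s _ => by rw [add_comm]
  · induction N with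
    | zero => simp
    | succ N ih =>
      rw [prod_range_succ _ N, prod_range_succ (fun x => ∏ j ∈ range x, iv (2 * (x + j + 1))) N, ← ih]
      simp only [Nat.add_sub_cancel, Nat.sub_self, range_zero, prod_empty, mul_one]
      rw [← prod_mul_distrib]
      refine prod_congr rfl fun s hs => ?_
      rw [mem_range] at hs
      rw [show N - s = N - 1 - s + 1 by omega, prod_range_succ]
      congr 2
      omega

/-- the generating function of symmetric plane partitions with at most `N`
rows and `N` columns equals
`∏_{i=0}^{N−1} [(1 − q^{2i+1}) · ∏_{j=0}^{i−1} (1 − q^{2(i+j+1)})]^{−1}` in `ℤ[[q]]`. -/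
theorem stmt14 (N : ℕ) :
    (PowerSeries.mk fun n =>
        (Nat.card {π : ℕ → ℕ → ℕ // IsSymPP N π ∧ ppSize N π = n} : ℤ))
      = ∏ i ∈ range N, Ring.inverse
          ((1 - (X : PowerSeries ℤ) ^ (2 * i + 1)) *
            ∏ j ∈ range i, (1 - (X : PowerSeries ℤ) ^ (2 * (i + j + 1)))) := by
  rw [prod_congr rfl fun i _ => inverse_prod i, ← prod_rearrange]
  have h := (hasGF_AA N 1 le_rfl).equiv (w' := fun p => ppSize N p.1) (ppEquiv N) (ppEquiv_size N)
  ext n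
  rw [coeff_mk, ← (h n).2]
  congr 1
  exact Nat.card_congr (Equiv.subtypeSubtypeEquivSubtypeInter _ (fun π => ppSize N π = n)).symm

end
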